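/- Fix a ∈ ℂ∖{0} and λ ∈ ℝ∖{0}. Define f_a(ζ) = (aζ, 0, …, 0, |a|²/2) and g_{a,λ}(ζ) = (−λ·conj(a), (iλ/2)·conj(A_{2̄1̄})·a·(2 − ζ² − |ζ|²), …, (iλ/2)·conj(A_{(n−1)‾1̄})·a·(2 − ζ² − |ζ|²), λζ). Then the pair (f_a, g_{a,λ}) satisfies the interior equations (★) at every ζ ∈ Δ and the boundary conditions (B1) and (B2) at every ζ ∈ ∂Δ; moreover ζ̄·gₙ(ζ) = λ ≠ 0 for every ζ ∈ ∂Δ. Hence (f_a, g_{a,λ}) is the lift of a stationary disc of Γ⁰ for the osculating structure J⁰. -/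

import Mathlib

open Complex ComplexConjugate Finset

noncomputable section

/-- Wirtinger derivative `∂F/∂ζ` of a scalar function. -/
def wderC (F : ℂ → ℂ) (ζ : ℂ) : ℂ :=
  (2⁻¹ : ℂ) * (fderiv ℝ F ζ 1 - Complex.I * fderiv ℝ F ζ Complex.I)

/-- Wirtinger derivative `∂F/∂ζ̄` of a scalar function. -/
def wbarC (F : ℂ → ℂ) (ζ : ℂ) : ℂ :=
  (2⁻¹ : ℂ) * (fderiv ℝ F ζ 1 + Complex.I * fderiv ℝ F ζ Complex.I)

/-- The interior equations (★) of the stationary-disc system for `(J⁰, Γ⁰)` at `ζ`. -/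
def starSystem (n : ℕ) (A : Fin n → Fin n → ℂ)
    (f g : ℂ → Fin (n+1) → ℂ) (ζ : ℂ) : Prop :=
  (∀ α : Fin n, wbarC (fun ζ' => f ζ' α.castSucc) ζ = 0) ∧
  (wbarC (fun ζ' => f ζ' (Fin.last n)) ζ -
    (Complex.I / 2) * ∑ α : Fin n, ∑ β : Fin n,
      A α β * conj (f ζ β.castSucc) * conj (wderC (fun ζ' => f ζ' α.castSucc) ζ) = 0) ∧
  (∀ α : Fin n, wbarC (fun ζ' => g ζ' α.castSucc) ζ +
    (Complex.I / 2) * ∑ β : Fin n,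
      conj (A α β) * f ζ β.castSucc *
        conj (wderC (fun ζ' => g ζ' (Fin.last n)) ζ) = 0) ∧
  wbarC (fun ζ' => g ζ' (Fin.last n)) ζ = 0

/-- The boundary conditions (B1), (B2) of the stationary-disc system at `ζ ∈ ∂Δ`. -/
def bdrySystem (n : ℕ) (A : Fin n → Fin n → ℂ)
    (f g : ℂ → Fin (n+1) → ℂ) (ζ : ℂ) : Prop :=
  (2 * (f ζ (Fin.last n)).re = ∑ α : Fin n, Complex.normSq (f ζ α.castSucc)) ∧
  (∀ α : Fin n,
    g ζ α.castSucc +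
      (conj (f ζ α.castSucc) +
        (Complex.I / 2) * ∑ β : Fin n, conj (A α β) * f ζ β.castSucc) *
        g ζ (Fin.last n) -
      (Complex.I / 2) * (∑ β : Fin n, conj (A α β) * f ζ β.castSucc) *
        conj (g ζ (Fin.last n)) = 0) ∧
  conj ζ * g ζ (Fin.last n) = ζ * conj (g ζ (Fin.last n))

/-- The explicit disc `f_a(ζ) = (aζ, 0, …, 0, |a|²/2)`. -/
def fa (n : ℕ) [NeZero n] (a : ℂ) (ζ : ℂ) : Fin (n+1) → ℂ :=
  Fin.snoc (fun α : Fin n => if α = 0 then a * ζ else 0) ((‖a‖ ^ 2 / 2 : ℝ) : ℂ)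

/-- The explicit lift `g_{a,λ}`. -/
def ga (n : ℕ) [NeZero n] (A : Fin n → Fin n → ℂ) (a : ℂ) (lam : ℝ) (ζ : ℂ) : Fin (n+1) → ℂ :=
  Fin.snoc (fun α : Fin n =>
      if α = 0 then -(lam : ℂ) * conj a
      else (Complex.I * lam / 2) * conj (A α 0) * a *
        (2 - ζ ^ 2 - (Complex.normSq ζ : ℂ)))
    ((lam : ℂ) * ζ)

theorem fderiv_real_apply_of_differentiableAt {F : ℂ → ℂ} {ζ : ℂ} (hF : DifferentiableAt ℂ F ζ)
    (v : ℂ) : fderiv ℝ F ζ v = v * deriv F ζ := by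
  rw [hF.fderiv_restrictScalars ℝ]
  simp

theorem wbarC_of_differentiableAt {F : ℂ → ℂ} {ζ : ℂ} (hF : DifferentiableAt ℂ F ζ) :
    wbarC F ζ = 0 := by
  simp only [wbarC, fderiv_real_apply_of_differentiableAt hF]
  linear_combination (2⁻¹ : ℂ) * deriv F ζ * Complex.I_sq

theorem wderC_of_differentiableAt {F : ℂ → ℂ} {ζ : ℂ} (hF : DifferentiableAt ℂ F ζ) :
    wderC F ζ = deriv F ζ := by
  simp only [wderC, fderiv_real_apply_of_differentiableAt hF]
  linear_combination -(2⁻¹ : ℂ) * deriv F ζ * Complex.I_sq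

theorem wbarC_mul_two_sub_sq_sub_normSq (c ζ : ℂ) :
    wbarC (fun z => c * (2 - z ^ 2 - (Complex.normSq z : ℂ))) ζ = -(c * ζ) := by
  have hid := hasFDerivAt_id (𝕜 := ℝ) ζ
  have hconj := Complex.conjCLE.toContinuousLinearMap.hasFDerivAt (x := ζ)
  have h : HasFDerivAt (fun z : ℂ => c * (2 - z * z - z * conj z)) _ ζ :=
    (((hid.mul hid).const_sub 2).sub (hid.mul hconj)).const_mul c
  have heq : (fun z => c * (2 - z ^ 2 - (Complex.normSq z : ℂ))) =
      fun z : ℂ => c * (2 - z * z - z * conj z) := by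
    funext z
    rw [Complex.mul_conj, sq]
  rw [heq, wbarC, h.fderiv]
  simp
  linear_combination -(2⁻¹ : ℂ) * c * (ζ + conj ζ) * Complex.I_sq

/-- the explicit pair `(f_a, g_{a,λ})` solves the interior equations (★) on
`Δ` and the boundary conditions (B1), (B2) on `∂Δ`, with `ζ̄·gₙ(ζ) = λ ≠ 0` there; hence
it is the lift of a stationary disc of `Γ⁰` for the osculating structure `J⁰`. -/
theorem stmt13 (n : ℕ) [NeZero n] (A : Fin n → Fin n → ℂ)
    (hA : ∀ α β, A α β = - A β α)
    (a : ℂ) (ha : a ≠ 0) (lam : ℝ) (hlam : lam ≠ 0) :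
    (∀ ζ ∈ Metric.ball (0:ℂ) 1, starSystem n A (fa n a) (ga n A a lam) ζ) ∧
    (∀ ζ ∈ Metric.sphere (0:ℂ) 1,
      bdrySystem n A (fa n a) (ga n A a lam) ζ ∧
      conj ζ * ga n A a lam ζ (Fin.last n) = (lam : ℂ)) := by
  have h00 : A 0 0 = 0 := self_eq_neg.mp (hA 0 0)
  have hlast : ∀ ζ, DifferentiableAt ℂ (fun z : ℂ => (lam : ℂ) * z) ζ := fun ζ => by fun_prop
  refine ⟨fun ζ _ => ⟨fun α => ?_, ?_, fun α => ?_, ?_⟩,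
    fun ζ hζ => ?_⟩
  · apply wbarC_of_differentiableAt
    simp only [fa, Fin.snoc_castSucc]
    split_ifs <;> fun_prop
  · have hf : wbarC (fun z => fa n a z (Fin.last n)) ζ = 0 := by
      apply wbarC_of_differentiableAt
      simp only [fa, Fin.snoc_last]
      fun_prop
    have hsum : ∀ α β : Fin n, A α β * conj (fa n a ζ β.castSucc) *
        conj (wderC (fun z => fa n a z α.castSucc) ζ) = 0 := by
      intro α β
      by_cases hα : α = 0
      · by_cases hβ : β = 0
        · simp [hα, hβ, h00]
        · simp [fa, hβ]
      · simp [fa, hα, wderC]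
    simp [hf, hsum]
  · have hw : wderC (fun z => (lam : ℂ) * z) ζ = lam := by
      rw [wderC_of_differentiableAt (hlast ζ)]
      simp
    by_cases hα : α = 0
    · simp [fa, ga, hα, h00, wbarC]
    · simp only [fa, ga, Fin.snoc_castSucc, Fin.snoc_last, hα, if_false, hw,
        wbarC_mul_two_sub_sq_sub_normSq]
      simp
      ring
  · simpa only [ga, Fin.snoc_last] using wbarC_of_differentiableAt (hlast ζ)
  · have hnorm : ‖ζ‖ = 1 := by simpa using hζ
    have hsq : Complex.normSq ζ = 1 := by simp [Complex.normSq_eq_norm_sq, hnorm]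
    have hmul : ζ * conj ζ = 1 := by simp [Complex.mul_conj, hsq]
    refine ⟨⟨?_, fun α => ?_, ?_⟩, ?_⟩
    · simp only [fa, Fin.snoc_castSucc, Fin.snoc_last, Complex.ofReal_re, apply_ite Complex.normSq]
      simp [Complex.normSq_eq_norm_sq, hnorm]
      ring
    · by_cases hα : α = 0
      · simp [fa, ga, hα, h00]
        linear_combination (lam : ℂ) * conj a * hmul
      · simp [fa, ga, hα, hsq]
        linear_combination -(Complex.I / 2) * conj (A α 0) * a * lam * hmul
    · simp [ga]
      ring
    · simp only [ga, Fin.snoc_last]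
      linear_combination (lam : ℂ) * hmul
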